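/- Let (m_n)_{n≥1} be a sequence of integers with m_n ≥ 2 and m_n → ∞, set μ_n = log m_n and t_n = (3·log n)/(2·μ_n), and assume lim_{n→∞} |d(t_n)|·μ_n = ∞. Then lim_{n→∞} min{‖Q_{n,m_n}^{k} − U_n‖_TV : k integer, 0 ≤ k ≤ t_n} = 1 and lim_{n→∞} sup{‖Q_{n,m_n}^{k} − U_n‖_TV : k integer, k ≥ t_n} = 0. -/

import Mathlib

open Filter MeasureTheory
open scoped BigOperators NNReal ENNReal

noncomputable section

/-- The value of `σ⁻¹` at position `i` (0-indexed), as a natural number; `0` out of range. -/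
def invAt (n : ℕ) (σ : Equiv.Perm (Fin n)) (i : ℕ) : ℕ :=
  if h : i < n then ((σ⁻¹ ⟨i, h⟩ : Fin n) : ℕ) else 0

/-- The number of rising sequences of a permutation: one plus the number of descents
of its inverse. -/
def rSeq (n : ℕ) (σ : Equiv.Perm (Fin n)) : ℕ :=
  1 + ((Finset.range (n - 1)).filter fun i => invAt n σ (i + 1) < invAt n σ i).card

/-- The `m`-shuffle distribution on `S_n`:  `Q_{n,m}(σ) = m^{-n} C(n + m - r(σ), n)`. -/
def Qs (n m : ℕ) (σ : Equiv.Perm (Fin n)) : ℝ :=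
  ((m : ℝ) ^ n)⁻¹ * (Nat.choose (n + m - rSeq n σ) n : ℝ)

/-- The uniform distribution on `S_n`. -/
def Us (n : ℕ) (_ : Equiv.Perm (Fin n)) : ℝ := (n.factorial : ℝ)⁻¹

/-- Total variation distance between two probability distributions on `S_n`. -/
def tv (n : ℕ) (μ ν : Equiv.Perm (Fin n) → ℝ) : ℝ :=
  (1 / 2) * ∑ σ : Equiv.Perm (Fin n), |μ σ - ν σ|

/-- Convolution of two distributions on `S_n`. -/
def convol (n : ℕ) (μ ν : Equiv.Perm (Fin n) → ℝ) : Equiv.Perm (Fin n) → ℝ :=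
  fun σ => ∑ τ : Equiv.Perm (Fin n), μ (σ * τ⁻¹) * ν τ

/-- `k`-fold convolution power; the `0`-th power is the point mass at the identity. -/
def iterConv (n : ℕ) (μ : Equiv.Perm (Fin n) → ℝ) : ℕ → Equiv.Perm (Fin n) → ℝ
  | 0 => fun σ => if σ = 1 then 1 else 0
  | k + 1 => convol n μ (iterConv n μ k)

/-- `Ψ(x) = (2π)^{-1/2} ∫_{-x/(4√3)}^{x/(4√3)} e^{-t²/2} dt`. -/
def Psi (x : ℝ) : ℝ :=
  (Real.sqrt (2 * Real.pi))⁻¹ *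
    ∫ t in (-(x / (4 * Real.sqrt 3)))..(x / (4 * Real.sqrt 3)), Real.exp (-t ^ 2 / 2)

/-- The `p`-shuffle distribution on `S_n` for a probability `p` on the positive integers. -/
def Qp (n : ℕ) (p : ℕ → ℝ) (σ : Equiv.Perm (Fin n)) : ℝ := ∑' m : ℕ, p m * Qs n m σ

/-- `{t}`: the nearest integer to `t` (rounding half up), except `{t} = 1/2` for `0 < t < 1/2`. -/
def curly (t : ℝ) : ℝ := if t < 1 / 2 then 1 / 2 else ((round t : ℤ) : ℝ)

/-- `d(t) = 1/2` for `0 < t < 1/2` and `d(t) = t - {t}` for `t ≥ 1/2`. -/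
def dOf (t : ℝ) : ℝ := if t < 1 / 2 then 1 / 2 else t - ((round t : ℤ) : ℝ)

theorem eq_sort_iff_forall_succ {k : ℕ} {α : Type*} [LinearOrder α]
    (w : Fin (k + 1) → α) (τ : Equiv.Perm (Fin (k + 1))) :
    τ = Tuple.sort w ↔ ∀ i : Fin k, w (τ i.castSucc) ≤ w (τ i.succ) ∧
      (τ i.succ < τ i.castSucc → w (τ i.castSucc) < w (τ i.succ)) := by
  rw [Tuple.eq_sort_iff', Fin.strictMono_iff_lt_succ]
  refine forall_congr' fun i => ?_
  have hne : τ i.castSucc ≠ τ i.succ := fun h => by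
    have := τ.injective h
    simp [Fin.ext_iff] at this
  change toLex (w (τ i.castSucc), τ i.castSucc) < toLex (w (τ i.succ), τ i.succ) ↔ _
  rw [Prod.Lex.toLex_lt_toLex]
  constructor
  · rintro (h | ⟨h, h'⟩)
    · exact ⟨h.le, fun _ => h⟩
    · exact ⟨h.le, fun h2 => absurd h2 (not_lt.2 h'.le)⟩
  · rintro ⟨h1, h2⟩
    rcases h1.lt_or_eq with h | h
    · exact Or.inl h
    · refine Or.inr ⟨h, lt_of_le_of_ne (not_lt.1 fun h3 => ?_) hne⟩
      exact absurd (h2 h3) (by rw [h]; exact lt_irrefl _)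

/-- The number of positions before `i` at which `T` does not descend. -/
def ascBefore (T : ℕ → ℕ) (i : ℕ) : ℕ :=
  ((Finset.range i).filter fun j => ¬ T (j + 1) < T j).card

theorem ascBefore_succ (T : ℕ → ℕ) (i : ℕ) :
    ascBefore T (i + 1) = ascBefore T i + if T (i + 1) < T i then 0 else 1 := by
  unfold ascBefore
  rw [Finset.range_add_one, Finset.filter_insert]
  split_ifs <;> simp_all

theorem ascBefore_le_add (T : ℕ → ℕ) (i d : ℕ) :
    ascBefore T (i + d) ≤ ascBefore T i + d := by
  induction d with
  | zero => simp
  | succ d ih => rw [← Nat.add_assoc, ascBefore_succ]; split_ifs <;> omega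

theorem add_sub_le_of_strictMono {k N : ℕ} {f : Fin k → Fin N} (hf : StrictMono f)
    {i j : Fin k} (hij : i ≤ j) : (f i : ℕ) + (j - i) ≤ f j := by
  have key : ∀ d, ∀ h : (i : ℕ) + d < k, (f i : ℕ) + d ≤ f ⟨i + d, h⟩ := by
    intro d
    induction d with
    | zero => intro h; simp
    | succ d ih =>
      intro h
      have h1 := ih (by omega)
      have h2 : f ⟨i + d, by omega⟩ < f ⟨i + (d + 1), h⟩ := hf (by simp [Fin.lt_def])
      rw [Fin.lt_def] at h2
      omega
  rw [Fin.le_def] at hij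
  have h := key (j - i) (by omega)
  have h' : (⟨i + (j - i), by omega⟩ : Fin k) = j := Fin.ext (by simp; omega)
  rwa [h'] at h

theorem ascBefore_le_of_strictMono (T : ℕ → ℕ) {k N : ℕ} {f : Fin k → Fin N}
    (hf : StrictMono f) (i : Fin k) : ascBefore T i ≤ f i := by
  have hi := i.2
  have h := add_sub_le_of_strictMono hf (i := ⟨0, by omega⟩) (j := i) (Nat.zero_le _)
  have h' := ascBefore_le_add T 0 i
  have h0 : ascBefore T 0 = 0 := by simp [ascBefore]
  simp only [h0, Nat.zero_add] at h'
  simp only [Nat.sub_zero] at h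
  omega

/-- Weakly increasing sequences, strict at the descents of `T`, correspond to order embeddings. -/
theorem card_weakly_increasing (T : ℕ → ℕ) (k m N : ℕ) (hN : N = m + ascBefore T k) :
    Nat.card {g : Fin (k + 1) → Fin m // ∀ i : Fin k, g i.castSucc ≤ g i.succ ∧
      (T (i + 1) < T i → g i.castSucc < g i.succ)} = N.choose (k + 1) := by
  have hmono : Monotone (ascBefore T) := monotone_nat_of_le_succ fun i => by
    rw [ascBefore_succ]; omega
  have e : {g : Fin (k + 1) → Fin m // ∀ i : Fin k, g i.castSucc ≤ g i.succ ∧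
      (T (i + 1) < T i → g i.castSucc < g i.succ)} ≃ (Fin (k + 1) ↪o Fin N) :=
    { toFun := fun g => OrderEmbedding.ofStrictMono
        (fun i => ⟨(g.1 i : ℕ) + ascBefore T i, by
          have h1 := (g.1 i).2
          have h2 := hmono (Nat.lt_succ_iff.1 i.2)
          omega⟩)
        (by
          rw [Fin.strictMono_iff_lt_succ]
          intro i
          have h := g.2 i
          simp only [Fin.lt_def, Fin.le_def, Fin.val_castSucc, Fin.val_succ, ascBefore_succ] at h ⊢
          split_ifs <;> omega)
      invFun := fun f => ⟨fun i => ⟨(f i : ℕ) - ascBefore T i, by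
          have h0 := ascBefore_le_of_strictMono T f.strictMono i
          have h1 := add_sub_le_of_strictMono f.strictMono (Fin.le_last i)
          have h2 := (f (Fin.last k)).2
          have h3 := ascBefore_le_add T i (k - i)
          have hi := i.2
          rw [show (i : ℕ) + (k - i) = k by omega] at h3
          simp only [Fin.val_last] at h1
          omega⟩, by
          intro i
          have h1 : f i.castSucc < f i.succ := f.strictMono (by simp [Fin.lt_def])
          have h2 := ascBefore_le_of_strictMono T f.strictMono i.castSucc
          have h3 := ascBefore_le_of_strictMono T f.strictMono i.succ
          simp only [Fin.lt_def, Fin.le_def, Fin.val_castSucc, Fin.val_succ,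
            ascBefore_succ] at h1 h2 h3 ⊢
          split_ifs at h3 ⊢ <;> omega⟩
      left_inv := fun g => by
        ext i
        simp
      right_inv := fun f => by
        ext i
        have := ascBefore_le_of_strictMono T f.strictMono i
        simp
        omega }
  rw [Nat.card_congr (e.trans Set.powersetCard.ofFinEmbEquiv), Set.powersetCard.card]
  simp

theorem rSeq_add_ascBefore (k : ℕ) (σ : Equiv.Perm (Fin (k + 1))) :
    rSeq (k + 1) σ + ascBefore (invAt (k + 1) σ) k = k + 1 := by
  have h := Finset.card_filter_add_card_filter_not (s := Finset.range k)
    (fun i => invAt (k + 1) σ (i + 1) < invAt (k + 1) σ i)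
  rw [Finset.card_range] at h
  unfold rSeq ascBefore
  rw [Nat.add_sub_cancel]
  omega

theorem card_sort_eq_fin (n m : ℕ) (σ : Equiv.Perm (Fin n)) :
    Nat.card {w : Fin n → Fin m // Tuple.sort w = σ⁻¹} = (n + m - rSeq n σ).choose n := by
  cases n with
  | zero =>
    have : Unique {w : Fin 0 → Fin m // Tuple.sort w = σ⁻¹} :=
      ⟨⟨⟨fun i => i.elim0, Subsingleton.elim _ _⟩⟩, fun a => Subsingleton.elim _ _⟩
    simp
  | succ k =>
    have hr := rSeq_add_ascBefore k σ
    rw [← card_weakly_increasing (invAt (k + 1) σ) k m _ (by omega)]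
    refine Nat.card_congr (Equiv.subtypeEquiv (Equiv.arrowCongr σ (Equiv.refl _)) fun w => ?_)
    rw [eq_comm, eq_sort_iff_forall_succ]
    refine forall_congr' fun i => ?_
    have h1 : (i : ℕ) < k + 1 := by omega
    have h2 : (i : ℕ) + 1 < k + 1 := by omega
    simp only [invAt, h1, h2, dif_pos]
    rfl

/-- The number of words over a linearly ordered alphabet of size `m` whose stable sorting
permutation is `σ⁻¹`. -/
theorem card_sort_eq {n m : ℕ} {α : Type*} [LinearOrder α] [Fintype α]
    (hα : Fintype.card α = m) (σ : Equiv.Perm (Fin n)) :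
    Nat.card {w : Fin n → α // Tuple.sort w = σ⁻¹} = (n + m - rSeq n σ).choose n := by
  rw [← card_sort_eq_fin]
  let e := (Fintype.orderIsoFinOfCardEq α hα).symm
  refine Nat.card_congr (Equiv.subtypeEquiv (Equiv.arrowCongr (Equiv.refl _) e.toEquiv)
    fun w => ?_)
  have h : Tuple.sort w = Tuple.sort (e ∘ w) := by
    rw [Tuple.eq_sort_iff]
    refine ⟨e.monotone.comp (Tuple.monotone_sort w), fun i j hij h => ?_⟩
    exact (Tuple.eq_sort_iff.1 (rfl : Tuple.sort w = Tuple.sort w)).2 i j hij (e.injective h)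
  rw [h]
  rfl

theorem sort_lex_eq {n : ℕ} {α β : Type*} [LinearOrder α] [LinearOrder β]
    (u : Fin n → α) (v : Fin n → β) :
    Tuple.sort (fun i => toLex (u ((Tuple.sort v)⁻¹ i), v i)) = Tuple.sort v * Tuple.sort u := by
  have hu := Tuple.eq_sort_iff.1 (rfl : Tuple.sort u = Tuple.sort u)
  have hv := Tuple.eq_sort_iff.1 (rfl : Tuple.sort v = Tuple.sort v)
  have hinv : ∀ x, (Tuple.sort v)⁻¹ (Tuple.sort v x) = x := Equiv.symm_apply_apply _
  symm
  rw [Tuple.eq_sort_iff]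
  constructor
  · intro i j hij
    rcases hij.lt_or_eq with hlt | rfl
    · simp only [Function.comp, Equiv.Perm.mul_apply, hinv]
      rw [Prod.Lex.toLex_le_toLex]
      rcases (hu.1 hij).lt_or_eq with h | h
      · exact Or.inl h
      · exact Or.inr ⟨h, hv.1 (hu.2 i j hlt h).le⟩
    · exact le_rfl
  · intro i j hij h
    simp only [Equiv.Perm.mul_apply, hinv, EmbeddingLike.apply_eq_iff_eq,
      Prod.mk.injEq] at h ⊢
    exact hv.2 _ _ (hu.2 i j hij h.1) h.2

/-- The number of words over `Fin m` whose stable sorting permutation is `σ⁻¹`. -/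
def sortCount (n m : ℕ) (σ : Equiv.Perm (Fin n)) : ℕ :=
  (Finset.univ.filter fun w : Fin n → Fin m => Tuple.sort w = σ⁻¹).card

theorem sortCount_eq_choose (n m : ℕ) (σ : Equiv.Perm (Fin n)) :
    sortCount n m σ = (n + m - rSeq n σ).choose n := by
  rw [← card_sort_eq_fin, sortCount, Nat.card_eq_fintype_card, Fintype.card_subtype]

theorem Qs_eq (n m : ℕ) (σ : Equiv.Perm (Fin n)) :
    Qs n m σ = ((m : ℝ) ^ n)⁻¹ * (sortCount n m σ : ℝ) := by
  rw [Qs, sortCount_eq_choose]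

theorem sum_sortCount (n m : ℕ) : ∑ σ : Equiv.Perm (Fin n), sortCount n m σ = m ^ n := by
  have h := Finset.card_eq_sum_card_fiberwise (s := (Finset.univ : Finset (Fin n → Fin m)))
    (t := (Finset.univ : Finset (Equiv.Perm (Fin n)))) (f := fun w => (Tuple.sort w)⁻¹)
    (fun _ _ => Finset.mem_coe.2 (Finset.mem_univ _))
  simp only [Finset.card_univ, Fintype.card_fun, Fintype.card_fin] at h
  rw [h]
  refine Finset.sum_congr rfl fun σ _ => ?_
  simp only [sortCount, inv_eq_iff_eq_inv]

theorem sum_sortCount_mul (n a b : ℕ) (σ : Equiv.Perm (Fin n)) :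
    ∑ τ : Equiv.Perm (Fin n), sortCount n a (σ * τ⁻¹) * sortCount n b τ =
      sortCount n (a * b) σ := by
  have hcard : Fintype.card (Fin a ×ₗ Fin b) = a * b := by
    rw [Fintype.card_lex, Fintype.card_prod, Fintype.card_fin, Fintype.card_fin]
  rw [sortCount_eq_choose n (a * b), ← card_sort_eq hcard, Nat.card_eq_fintype_card,
    Fintype.card_subtype]
  have key : (Finset.univ.filter fun p : (Fin n → Fin a) × (Fin n → Fin b) =>
      Tuple.sort p.2 * Tuple.sort p.1 = σ⁻¹).card =
      (Finset.univ.filter fun w : Fin n → Fin a ×ₗ Fin b => Tuple.sort w = σ⁻¹).card := by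
    refine Finset.card_bij
      (fun p _ => fun i => toLex (p.1 ((Tuple.sort p.2)⁻¹ i), p.2 i)) ?_ ?_ ?_
    · intro p hp
      rw [Finset.mem_filter] at hp ⊢
      exact ⟨Finset.mem_univ _, by rw [sort_lex_eq]; exact hp.2⟩
    · rintro ⟨u, v⟩ _ ⟨u', v'⟩ _ h
      have hv : v = v' := funext fun i => (Prod.mk.inj (toLex.injective (congrFun h i))).2
      subst hv
      have hu : u = u' := funext fun i => by
        have := (Prod.mk.inj (toLex.injective (congrFun h (Tuple.sort v i)))).1
        simpa using this
      rw [hu]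
    · intro w hw
      set v : Fin n → Fin b := fun i => (ofLex (w i)).2 with hv
      have he : (fun i => toLex ((fun j => (ofLex (w (Tuple.sort v j))).1)
          ((Tuple.sort v)⁻¹ i), v i)) = w := by
        funext i
        simp [hv]
      refine ⟨(fun j => (ofLex (w (Tuple.sort v j))).1, v), ?_, he⟩
      rw [Finset.mem_filter] at hw ⊢
      refine ⟨Finset.mem_univ _, ?_⟩
      rw [← sort_lex_eq]
      exact (congrArg Tuple.sort he).trans hw.2
  rw [← key, Finset.card_eq_sum_card_fiberwise
    (t := (Finset.univ : Finset (Equiv.Perm (Fin n)))) (f := fun p => (Tuple.sort p.2)⁻¹)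
    (fun _ _ => Finset.mem_coe.2 (Finset.mem_univ _))]
  refine Finset.sum_congr rfl fun τ _ => ?_
  rw [sortCount, sortCount, ← Finset.card_product]
  congr 1
  ext ⟨u, v⟩
  simp only [Finset.mem_product, Finset.mem_filter, Finset.mem_univ, true_and, mul_inv_rev,
    inv_inv]
  constructor
  · rintro ⟨h1, h2⟩
    rw [h1, h2]
    simp
  · rintro ⟨h1, h2⟩
    have h3 : Tuple.sort v = τ⁻¹ := by rw [← h2, inv_inv]
    refine ⟨?_, h3⟩
    rw [← h1, h3]
    simp

theorem convol_Qs (n a b : ℕ) : convol n (Qs n a) (Qs n b) = Qs n (a * b) := by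
  funext σ
  rw [Qs_eq, ← sum_sortCount_mul, convol]
  push_cast
  rw [Finset.mul_sum]
  refine Finset.sum_congr rfl fun τ _ => ?_
  rw [Qs_eq, Qs_eq, mul_pow, mul_inv]
  ring

theorem iterConv_Qs (n m k : ℕ) : iterConv n (Qs n m) k = Qs n (m ^ k) := by
  induction k with
  | zero =>
    funext σ
    have h : ∀ w : Fin n → Fin 1, Tuple.sort w = 1 := fun w =>
      Tuple.sort_eq_refl_iff_monotone.2 fun i j _ => (Subsingleton.elim _ _).le
    rw [Qs_eq, sortCount, pow_zero, iterConv]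
    by_cases hσ : σ = 1
    · rw [Finset.filter_true_of_mem fun w _ => by rw [h w, hσ, inv_one]]
      simp [hσ]
    · rw [Finset.filter_false_of_mem fun w _ => by rwa [h w, eq_comm, inv_eq_one]]
      simp [hσ]
  | succ k ih => rw [iterConv, ih, convol_Qs, pow_succ']

theorem sum_Qs (n m : ℕ) (hm : 0 < m) : ∑ σ : Equiv.Perm (Fin n), Qs n m σ = 1 := by
  simp only [Qs_eq]
  rw [← Finset.mul_sum, ← Nat.cast_sum, sum_sortCount, Nat.cast_pow]
  exact inv_mul_cancel₀ (by positivity)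

/-- The sign of the step of `σ⁻¹` at position `i`: `-1` at a descent, `1` otherwise. -/
def stepSign (n : ℕ) (i : ℕ) (σ : Equiv.Perm (Fin n)) : ℝ :=
  if invAt n σ (i + 1) < invAt n σ i then -1 else 1

/-- The deviation of the number of rising sequences below its mean under the uniform law. -/
def rDev (n : ℕ) (σ : Equiv.Perm (Fin n)) : ℝ := ((n : ℝ) + 1) / 2 - rSeq n σ

theorem rDev_eq_sum {n : ℕ} (hn : 0 < n) (σ : Equiv.Perm (Fin n)) :
    rDev n σ = (1 / 2) * ∑ i ∈ Finset.range (n - 1), stepSign n i σ := by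
  have h : ∀ i, stepSign n i σ = 1 - 2 * (if invAt n σ (i + 1) < invAt n σ i then 1 else 0) := by
    intro i
    unfold stepSign
    split_ifs <;> norm_num
  simp only [h, Finset.sum_sub_distrib, ← Finset.mul_sum, Finset.sum_boole, Finset.sum_const,
    Finset.card_range, rDev, rSeq]
  have hn' : ((n - 1 : ℕ) : ℝ) = n - 1 := by push_cast [Nat.cast_sub (show 1 ≤ n from hn)]; rfl
  rw [nsmul_eq_mul, hn']
  push_cast
  ring

theorem invAt_swap_mul {n i : ℕ} (hi : i + 1 < n) (σ : Equiv.Perm (Fin n)) (j : ℕ) (hj : j < n) :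
    invAt n (Equiv.swap ⟨i, by omega⟩ ⟨i + 1, hi⟩ * σ) j =
      invAt n σ (if j = i then i + 1 else if j = i + 1 then i else j) := by
  have hi' : i < n := by omega
  simp only [invAt, hj, dif_pos, mul_inv_rev, Equiv.swap_inv, Equiv.Perm.mul_apply]
  split_ifs with h1 h2 <;> simp_all [Equiv.swap_apply_def]

theorem stepSign_swap_mul_self {n i : ℕ} (hi : i + 1 < n) (σ : Equiv.Perm (Fin n)) :
    stepSign n i (Equiv.swap ⟨i, by omega⟩ ⟨i + 1, hi⟩ * σ) = -stepSign n i σ := by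
  have hi' : i < n := by omega
  have hne : invAt n σ i ≠ invAt n σ (i + 1) := by
    simp only [invAt, hi, hi', dif_pos]
    intro h
    have := (σ⁻¹).injective (Fin.ext h)
    simp at this
  unfold stepSign
  rw [invAt_swap_mul hi σ i hi', invAt_swap_mul hi σ (i + 1) hi]
  simp only [if_true, Nat.succ_ne_self, if_false]
  rcases lt_or_gt_of_ne hne with h | h <;> simp [h, h.not_gt]

theorem stepSign_swap_mul_of_disjoint {n i j : ℕ} (hi : i + 1 < n) (hj : j + 1 < n)
    (hij : i + 1 < j ∨ j + 1 < i) (σ : Equiv.Perm (Fin n)) :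
    stepSign n j (Equiv.swap ⟨i, by omega⟩ ⟨i + 1, hi⟩ * σ) = stepSign n j σ := by
  unfold stepSign
  rw [invAt_swap_mul hi σ j (by omega), invAt_swap_mul hi σ (j + 1) hj,
    if_neg (show j ≠ i by omega), if_neg (show j ≠ i + 1 by omega),
    if_neg (show j + 1 ≠ i by omega), if_neg (show j + 1 ≠ i + 1 by omega)]

theorem sum_stepSign_mul_eq_zero {n i j : ℕ} (hi : i + 1 < n) (hj : j + 1 < n)
    (hij : i + 1 < j ∨ j + 1 < i) :
    ∑ σ : Equiv.Perm (Fin n), stepSign n i σ * stepSign n j σ = 0 := by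
  have h := Equiv.sum_comp (Equiv.mulLeft (Equiv.swap (⟨i, by omega⟩ : Fin n) ⟨i + 1, hi⟩))
    (fun σ => stepSign n i σ * stepSign n j σ)
  simp only [Equiv.coe_mulLeft, stepSign_swap_mul_self hi,
    stepSign_swap_mul_of_disjoint hi hj hij, neg_mul, Finset.sum_neg_distrib] at h
  linarith

theorem sum_rDev_sq_le {n : ℕ} (hn : 0 < n) :
    ∑ σ : Equiv.Perm (Fin n), rDev n σ ^ 2 ≤ n.factorial * n := by
  have hexp : ∀ σ : Equiv.Perm (Fin n), rDev n σ ^ 2 = (1 / 4) *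
      ∑ i ∈ Finset.range (n - 1), ∑ j ∈ Finset.range (n - 1), stepSign n i σ * stepSign n j σ := by
    intro σ
    rw [rDev_eq_sum hn, mul_pow, sq (∑ i ∈ _, _), Finset.sum_mul_sum]
    norm_num
  simp only [hexp]
  rw [← Finset.mul_sum, Finset.sum_comm]
  have hrow : ∀ i ∈ Finset.range (n - 1), ∑ σ : Equiv.Perm (Fin n),
      ∑ j ∈ Finset.range (n - 1), stepSign n i σ * stepSign n j σ ≤ 3 * n.factorial := by
    intro i hi
    rw [Finset.mem_range] at hi
    rw [Finset.sum_comm]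
    have hentry : ∀ j ∈ Finset.range (n - 1), ∑ σ : Equiv.Perm (Fin n),
        stepSign n i σ * stepSign n j σ ≤
        if j ∈ Finset.Icc (i - 1) (i + 1) then (n.factorial : ℝ) else 0 := by
      intro j hj
      rw [Finset.mem_range] at hj
      split_ifs with h
      · calc ∑ σ : Equiv.Perm (Fin n), stepSign n i σ * stepSign n j σ
            ≤ ∑ _σ : Equiv.Perm (Fin n), (1 : ℝ) := by
              refine Finset.sum_le_sum fun σ _ => ?_
              unfold stepSign
              split_ifs <;> norm_num
          _ = n.factorial := by simp [Fintype.card_perm]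
      · rw [Finset.mem_Icc] at h
        exact (sum_stepSign_mul_eq_zero (by omega) (by omega) (by omega)).le
    refine (Finset.sum_le_sum hentry).trans ?_
    rw [← Finset.sum_filter, Finset.sum_const, nsmul_eq_mul]
    gcongr
    have h1 : ((Finset.range (n - 1)).filter fun j => j ∈ Finset.Icc (i - 1) (i + 1)).card ≤
        (Finset.Icc (i - 1) (i + 1)).card :=
      Finset.card_le_card fun j hj => (Finset.mem_filter.1 hj).2
    rw [Nat.card_Icc] at h1
    have h2 : ((Finset.range (n - 1)).filter fun j => j ∈ Finset.Icc (i - 1) (i + 1)).card ≤ 3 := by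
      omega
    exact_mod_cast h2
  have h := Finset.sum_le_sum hrow
  rw [Finset.sum_const, Finset.card_range, nsmul_eq_mul] at h
  have h1 : ((n - 1 : ℕ) : ℝ) ≤ n := by exact_mod_cast Nat.sub_le n 1
  have h2 : (0 : ℝ) ≤ n.factorial := by positivity
  nlinarith [mul_le_mul_of_nonneg_right h1 h2, mul_nonneg h2 (Nat.cast_nonneg (α := ℝ) n)]

theorem rSeq_le {n : ℕ} (hn : 0 < n) (σ : Equiv.Perm (Fin n)) : rSeq n σ ≤ n := by
  have := Finset.card_filter_le (Finset.range (n - 1))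
    (fun i => invAt n σ (i + 1) < invAt n σ i)
  rw [Finset.card_range] at this
  unfold rSeq
  omega

/-- The density of the `M`-shuffle with respect to the uniform distribution. -/
def shuffleDensity (n M : ℕ) (σ : Equiv.Perm (Fin n)) : ℝ := n.factorial * Qs n M σ

theorem shuffleDensity_nonneg (n M : ℕ) (σ : Equiv.Perm (Fin n)) :
    0 ≤ shuffleDensity n M σ := by
  unfold shuffleDensity Qs
  positivity

theorem shuffleDensity_eq_prod {n M : ℕ} (hn : 0 < n) (hM : 0 < M) (σ : Equiv.Perm (Fin n)) :
    shuffleDensity n M σ = ∏ j ∈ Finset.range n,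
      (1 + rDev n σ / M + (((n : ℝ) - 1) / 2 - j) / M) := by
  have hr := rSeq_le hn σ
  have hM' : (M : ℝ) ≠ 0 := by positivity
  have h1 : (n.factorial : ℝ) * ((n + M - rSeq n σ).choose n : ℝ) =
      ∏ j ∈ Finset.range n, (((n + M - rSeq n σ : ℕ) : ℝ) - j) := by
    rw [← descPochhammer_eval_eq_prod_range, descPochhammer_eval_eq_descFactorial,
      Nat.descFactorial_eq_factorial_mul_choose]
    push_cast
    rfl
  calc shuffleDensity n M σ
      = ((M : ℝ) ^ n)⁻¹ * ∏ j ∈ Finset.range n, (((n + M - rSeq n σ : ℕ) : ℝ) - j) := by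
        rw [← h1, shuffleDensity, Qs]; ring
    _ = ∏ j ∈ Finset.range n, ((M : ℝ)⁻¹ * (((n + M - rSeq n σ : ℕ) : ℝ) - j)) := by
        rw [Finset.prod_mul_distrib, Finset.prod_const, Finset.card_range, inv_pow]
    _ = _ := by
        refine Finset.prod_congr rfl fun j _ => ?_
        rw [Nat.cast_sub (by omega), rDev]
        push_cast
        field_simp
        ring

theorem shuffleDensity_sq {n M : ℕ} (hn : 0 < n) (hM : 0 < M) (σ : Equiv.Perm (Fin n)) :
    shuffleDensity n M σ ^ 2 = ∏ j ∈ Finset.range n,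
      ((1 + rDev n σ / M) ^ 2 - ((((n : ℝ) - 1) / 2 - j) / M) ^ 2) := by
  have h := shuffleDensity_eq_prod hn hM σ
  have h' : shuffleDensity n M σ = ∏ j ∈ Finset.range n,
      (1 + rDev n σ / M - (((n : ℝ) - 1) / 2 - j) / M) := by
    rw [h, ← Finset.prod_range_reflect]
    refine Finset.prod_congr rfl fun j hj => ?_
    rw [Finset.mem_range] at hj
    rw [Nat.cast_sub (by omega), Nat.cast_sub (by omega)]
    push_cast
    ring
  rw [sq]
  nth_rewrite 1 [h]
  rw [h', ← Finset.prod_mul_distrib]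
  exact Finset.prod_congr rfl fun j _ => by ring

theorem sum_shuffleDensity (n M : ℕ) (hM : 0 < M) :
    ∑ σ : Equiv.Perm (Fin n), shuffleDensity n M σ = n.factorial := by
  simp only [shuffleDensity]
  rw [← Finset.mul_sum, sum_Qs n M hM, mul_one]

theorem tv_Qs_Us (n M : ℕ) : tv n (Qs n M) (Us n) =
    (1 / 2) * ((n.factorial : ℝ)⁻¹ * ∑ σ : Equiv.Perm (Fin n), |shuffleDensity n M σ - 1|) := by
  have hf : (0 : ℝ) < n.factorial := by positivity
  rw [tv, Finset.mul_sum _ _ ((n.factorial : ℝ)⁻¹)]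
  congr 1
  refine Finset.sum_congr rfl fun σ _ => ?_
  have h : Qs n M σ - Us n σ = (n.factorial : ℝ)⁻¹ * (shuffleDensity n M σ - 1) := by
    rw [shuffleDensity, Us]
    field_simp
  rw [h, abs_mul, abs_of_pos (inv_pos.2 hf)]

theorem sum_const_perm (n : ℕ) (c : ℝ) :
    ∑ _σ : Equiv.Perm (Fin n), c = n.factorial * c := by
  simp [Fintype.card_perm]

theorem tv_Qs_le_one (n M : ℕ) (hM : 0 < M) : tv n (Qs n M) (Us n) ≤ 1 := by
  have hf : (0 : ℝ) < n.factorial := by positivity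
  rw [tv_Qs_Us]
  have h : ∑ σ : Equiv.Perm (Fin n), |shuffleDensity n M σ - 1| ≤
      ∑ σ : Equiv.Perm (Fin n), (shuffleDensity n M σ + 1) := by
    refine Finset.sum_le_sum fun σ _ => ?_
    have := shuffleDensity_nonneg n M σ
    rw [abs_le]
    constructor <;> linarith
  rw [Finset.sum_add_distrib, sum_shuffleDensity n M hM, sum_const_perm] at h
  have h2 := mul_le_mul_of_nonneg_left h (inv_pos.2 hf).le
  have h3 : (n.factorial : ℝ)⁻¹ * (n.factorial + n.factorial * 1) = 2 := by field_simp; norm_num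
  linarith

theorem tv_nonneg (n : ℕ) (μ ν : Equiv.Perm (Fin n) → ℝ) : 0 ≤ tv n μ ν := by
  unfold tv
  positivity

/-- A pointwise lower bound on the density, in terms of the deviation of the number of rising
sequences. -/
theorem one_sub_le_shuffleDensity_sq {n M : ℕ} (hn : 0 < n) (hM : 0 < M)
    (σ : Equiv.Perm (Fin n)) :
    1 - n * (2 * |rDev n σ| / M + (n : ℝ) ^ 2 / (4 * (M : ℝ) ^ 2)) ≤
      shuffleDensity n M σ ^ 2 := by
  set a : ℝ := 2 * |rDev n σ| / M + (n : ℝ) ^ 2 / (4 * (M : ℝ) ^ 2) with ha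
  have hMr : (0 : ℝ) < M := by positivity
  have ha0 : 0 ≤ a := by positivity
  have hn1 : (1 : ℝ) ≤ n := by exact_mod_cast hn
  rcases le_or_gt a 1 with h1 | h1
  · rw [shuffleDensity_sq hn hM]
    calc 1 - n * a = 1 + (n : ℝ) * (-a) := by ring
      _ ≤ (1 + -a) ^ n := one_add_mul_le_pow (by linarith) n
      _ = ∏ _j ∈ Finset.range n, (1 + -a) := by simp
      _ ≤ _ := by
        refine Finset.prod_le_prod (fun _ _ => by linarith) fun j hj => ?_
        have hj' : (j : ℝ) + 1 ≤ n := by exact_mod_cast Finset.mem_range.1 hj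
        have hj0 : (0 : ℝ) ≤ j := by positivity
        have hs : (((n : ℝ) - 1) / 2 - j) ^ 2 ≤ (n : ℝ) ^ 2 / 4 := by nlinarith
        have hs' : ((((n : ℝ) - 1) / 2 - j) / M) ^ 2 ≤ (n : ℝ) ^ 2 / (4 * (M : ℝ) ^ 2) := by
          rw [div_pow, ← div_div]
          gcongr
        have hy : -(2 * |rDev n σ| / M) ≤ 2 * (rDev n σ / M) := by
          rw [← mul_div_assoc, ← neg_div]
          gcongr
          linarith [neg_abs_le (rDev n σ)]
        nlinarith [sq_nonneg (rDev n σ / M)]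
  · nlinarith [sq_nonneg (shuffleDensity n M σ)]

theorem tv_Qs_le {n M : ℕ} (hn : 0 < n) (hM : 0 < M) :
    tv n (Qs n M) (Us n) ≤ 2 * (n * √n / M) + (n * √n / M) ^ 2 / 4 := by
  have hf : (0 : ℝ) < n.factorial := by positivity
  have hMr : (0 : ℝ) < M := by positivity
  have hnr : (0 : ℝ) < n := by positivity
  have hs : (0 : ℝ) < √n := Real.sqrt_pos.2 hnr
  have hs2 : √(n : ℝ) ^ 2 = n := Real.sq_sqrt hnr.le
  have hpt : ∀ σ : Equiv.Perm (Fin n), |shuffleDensity n M σ - 1| ≤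
      (shuffleDensity n M σ - 1) + (2 * (n * √n / M) + (n * √n / M) ^ 2 / 2
        + 2 * √n / M * rDev n σ ^ 2) := by
    intro σ
    have h0 := shuffleDensity_nonneg n M σ
    have h1 := one_sub_le_shuffleDensity_sq hn hM σ
    have h2 : |rDev n σ| ≤ √n / 2 + rDev n σ ^ 2 / (2 * √n) := by
      have : √n / 2 + rDev n σ ^ 2 / (2 * √n) - |rDev n σ| = (|rDev n σ| - √n) ^ 2 / (2 * √n) := by
        rw [← sq_abs (rDev n σ)]
        field_simp
        ring
      have : 0 ≤ (|rDev n σ| - √n) ^ 2 / (2 * √n) := by positivity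
      linarith
    have h3 : (n : ℝ) * (2 * |rDev n σ| / M + (n : ℝ) ^ 2 / (4 * (M : ℝ) ^ 2)) ≤
        (n * √n / M) + (n * √n / M) ^ 2 / 4 + √n / M * rDev n σ ^ 2 := by
      have h4 : (n : ℝ) * (2 * |rDev n σ| / M) ≤
          n * (2 * (√n / 2 + rDev n σ ^ 2 / (2 * √n)) / M) := by gcongr
      have h5 : (n : ℝ) * (2 * (√n / 2 + rDev n σ ^ 2 / (2 * √n)) / M) =
          n * √n / M + √n / M * rDev n σ ^ 2 := by
        field_simp
        rw [hs2]
      have h6 : (n : ℝ) * ((n : ℝ) ^ 2 / (4 * (M : ℝ) ^ 2)) = (n * √n / M) ^ 2 / 4 := by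
        rw [div_pow, mul_pow, hs2]
        field_simp
      linarith [mul_add (n : ℝ) (2 * |rDev n σ| / M) ((n : ℝ) ^ 2 / (4 * (M : ℝ) ^ 2))]
    have h7 : 0 ≤ (n * √n / M) + (n * √n / M) ^ 2 / 4 + √n / M * rDev n σ ^ 2 := by positivity
    have h8 : 2 * √n / M * rDev n σ ^ 2 = 2 * (√n / M * rDev n σ ^ 2) := by ring
    rw [h8, abs_le]
    constructor
    · nlinarith
    · linarith
  have hsum := Finset.sum_le_sum fun σ (_ : σ ∈ Finset.univ) => hpt σ
  rw [Finset.sum_add_distrib, Finset.sum_sub_distrib, sum_shuffleDensity n M hM, sum_const_perm,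
    Finset.sum_add_distrib, sum_const_perm, ← Finset.mul_sum] at hsum
  have hv : 2 * √n / M * ∑ σ : Equiv.Perm (Fin n), rDev n σ ^ 2 ≤
      2 * √n / M * (n.factorial * n) :=
    mul_le_mul_of_nonneg_left (sum_rDev_sq_le hn) (by positivity)
  rw [tv_Qs_Us, ← mul_assoc, mul_comm (1 / 2 : ℝ), mul_assoc, inv_mul_le_iff₀ hf]
  have h9 : 2 * √n / M * (n.factorial * n) = n.factorial * (2 * (n * √n / M)) := by ring
  linarith

theorem sum_range_centered_sq (n : ℕ) : ∑ j ∈ Finset.range n, (((n : ℝ) - 1) / 2 - j) ^ 2 =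
    n * ((n : ℝ) ^ 2 - 1) / 12 := by
  have h : ∀ (c : ℝ) (n : ℕ), ∑ j ∈ Finset.range n, (c - j) ^ 2 =
      n * c ^ 2 - c * (n * (n - 1)) + n * (n - 1) * (2 * n - 1) / 6 := by
    intro c n
    induction n with
    | zero => simp
    | succ n ih =>
      rw [Finset.sum_range_succ, ih]
      push_cast
      ring
  rw [h]
  ring

theorem shuffleDensity_eq_zero {n M : ℕ} {σ : Equiv.Perm (Fin n)} (hn : 0 < n)
    (h : M < rSeq n σ) : shuffleDensity n M σ = 0 := by
  have hr := rSeq_le hn σ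
  rw [shuffleDensity, Qs, Nat.choose_eq_zero_of_lt (by omega)]
  simp

/-- A pointwise upper bound on the density: permutations with a typical number of rising
sequences have small density when `M` is much smaller than `n ^ (3 / 2)`. -/
theorem shuffleDensity_le {n M : ℕ} {K : ℝ} (hn : 2 ≤ n) (hM : 0 < M)
    (hKn : K * √n ≤ n / 4) (hq : 256 * K ≤ n * √n / M) (σ : Equiv.Perm (Fin n))
    (hσ : |rDev n σ| < K * √n) : shuffleDensity n M σ ≤ 12 / (n * √n / M) := by
  have hMr : (0 : ℝ) < M := by positivity
  have hn2 : (2 : ℝ) ≤ n := by exact_mod_cast hn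
  have hnr : (0 : ℝ) < n := by linarith
  have hs : (0 : ℝ) < √n := Real.sqrt_pos.2 hnr
  have hs2 : √(n : ℝ) ^ 2 = n := Real.sq_sqrt hnr.le
  set q : ℝ := n * √n / M with hqdef
  have hq0 : 0 < q := by positivity
  rcases lt_or_ge M (rSeq n σ) with hlt | hge
  · rw [shuffleDensity_eq_zero (by omega) hlt]
    positivity
  have hge' : (rSeq n σ : ℝ) ≤ M := by exact_mod_cast hge
  have hy := abs_lt.1 hσ
  have hyM : ((n : ℝ) + 1) / 2 ≤ M + rDev n σ := by rw [rDev]; linarith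
  have hyM' : rDev n σ ≤ M := by linarith
  have hu0 : 0 < 1 + rDev n σ / M := by
    have : 1 + rDev n σ / M = (M + rDev n σ) / M := by field_simp
    rw [this]
    have : 0 < M + rDev n σ := by linarith
    positivity
  have hu2 : 1 + rDev n σ / M ≤ 2 := by
    have := (div_le_one hMr).2 hyM'
    linarith
  have hsq : shuffleDensity n M σ ^ 2 ≤ Real.exp (2 * K * q - q ^ 2 / 64) := by
    rw [shuffleDensity_sq (by omega) hM]
    calc ∏ j ∈ Finset.range n,
          ((1 + rDev n σ / M) ^ 2 - ((((n : ℝ) - 1) / 2 - j) / M) ^ 2)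
        ≤ ∏ j ∈ Finset.range n,
          Real.exp (2 * (rDev n σ / M) - (((n : ℝ) - 1) / 2 - j) ^ 2 / (4 * (M : ℝ) ^ 2)) := by
          refine Finset.prod_le_prod (fun j hj => ?_) fun j hj => ?_
          · have hj' : (j : ℝ) + 1 ≤ n := by exact_mod_cast Finset.mem_range.1 hj
            have hj0 : (0 : ℝ) ≤ j := by positivity
            rw [sub_nonneg, sq_le_sq, abs_of_pos hu0, abs_div, abs_of_pos hMr, div_le_iff₀ hMr,
              show (1 + rDev n σ / M) * M = M + rDev n σ by field_simp, abs_le]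
            constructor <;> linarith
          · set u := 1 + rDev n σ / M with hu
            set v := (((n : ℝ) - 1) / 2 - j) / M with hv
            have h1 : u ^ 2 ≤ Real.exp (2 * (rDev n σ / M)) := by
              have h := Real.add_one_le_exp (rDev n σ / M)
              have h' : Real.exp (2 * (rDev n σ / M)) = Real.exp (rDev n σ / M) ^ 2 := by
                rw [sq, ← Real.exp_add]; congr 1; ring
              rw [h']
              gcongr
              linarith
            have h2 : 1 - v ^ 2 / u ^ 2 ≤ Real.exp (-(v ^ 2 / 4)) := by
              have h := Real.add_one_le_exp (-(v ^ 2 / 4))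
              have h' : v ^ 2 / 4 ≤ v ^ 2 / u ^ 2 := by
                gcongr
                nlinarith
              linarith
            have h3 : u ^ 2 - v ^ 2 = u ^ 2 * (1 - v ^ 2 / u ^ 2) := by field_simp
            have h4 : 2 * (rDev n σ / M) - (((n : ℝ) - 1) / 2 - j) ^ 2 / (4 * (M : ℝ) ^ 2) =
                2 * (rDev n σ / M) + -(v ^ 2 / 4) := by
              rw [hv]; field_simp; ring
            rw [h3, h4, Real.exp_add]
            exact (mul_le_mul_of_nonneg_left h2 (by positivity)).trans
              (mul_le_mul_of_nonneg_right h1 (Real.exp_pos _).le)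
      _ = Real.exp (n * (2 * (rDev n σ / M)) -
            n * ((n : ℝ) ^ 2 - 1) / 12 / (4 * (M : ℝ) ^ 2)) := by
          rw [← Real.exp_sum, Finset.sum_sub_distrib, ← Finset.sum_div, sum_range_centered_sq]
          simp
      _ ≤ _ := by
          refine Real.exp_le_exp.2 (sub_le_sub ?_ ?_)
          · have : n * (2 * (rDev n σ / M)) ≤ n * (2 * (K * √n / M)) := by
              gcongr
              exact hy.2.le
            refine this.trans (le_of_eq ?_)
            rw [hqdef]; ring
          · have : q ^ 2 / 64 = n * ((n : ℝ) ^ 2 / 16) / (4 * (M : ℝ) ^ 2) := by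
              rw [hqdef, div_pow, mul_pow, hs2]
              field_simp
              norm_num
            rw [this]
            gcongr
            nlinarith
  have h1 : 2 * K * q - q ^ 2 / 64 ≤ -(q ^ 2 / 128) := by nlinarith
  have h2 : Real.exp (-(q ^ 2 / 128)) ≤ (12 / q) ^ 2 := by
    rw [Real.exp_neg, div_pow 12 q]
    have h3 : q ^ 2 / 128 ≤ Real.exp (q ^ 2 / 128) := by
      linarith [Real.add_one_le_exp (q ^ 2 / 128)]
    calc (Real.exp (q ^ 2 / 128))⁻¹ ≤ (q ^ 2 / 128)⁻¹ := by gcongr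
      _ = 128 / q ^ 2 := by rw [inv_div]
      _ ≤ 12 ^ 2 / q ^ 2 := by gcongr; norm_num
  exact le_of_sq_le_sq (hsq.trans ((Real.exp_le_exp.2 h1).trans h2)) (by positivity)

theorem le_tv_Qs {n M : ℕ} {K : ℝ} (hK : 0 < K) (hn : 2 ≤ n) (hM : 0 < M)
    (hKn : K * √n ≤ n / 4) (hq : 256 * K ≤ n * √n / M) :
    1 - 12 / (n * √n / M) - 1 / K ^ 2 ≤ tv n (Qs n M) (Us n) := by
  have hf : (0 : ℝ) < n.factorial := by positivity
  have hnr : (0 : ℝ) < n := by positivity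
  have hs2 : √(n : ℝ) ^ 2 = n := Real.sq_sqrt hnr.le
  have hδ : 0 ≤ 12 / (n * √n / M) := by positivity
  have hpt : ∀ σ : Equiv.Perm (Fin n), (shuffleDensity n M σ - 1) +
      (2 * (1 - 12 / (n * √n / M)) - 2 / (K ^ 2 * n) * rDev n σ ^ 2) ≤
      |shuffleDensity n M σ - 1| := by
    intro σ
    have h0 : 0 ≤ 2 / (K ^ 2 * n) * rDev n σ ^ 2 := by positivity
    rcases lt_or_ge |rDev n σ| (K * √n) with h | h
    · have := shuffleDensity_le hn hM hKn hq σ h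
      linarith [neg_abs_le (shuffleDensity n M σ - 1)]
    · have h1 : K ^ 2 * n ≤ rDev n σ ^ 2 := by
        rw [← sq_abs (rDev n σ), ← hs2, ← mul_pow]
        gcongr
      have h2 : 2 ≤ 2 / (K ^ 2 * n) * rDev n σ ^ 2 := by
        rw [div_mul_eq_mul_div, le_div_iff₀ (by positivity)]
        linarith
      linarith [le_abs_self (shuffleDensity n M σ - 1)]
  have hsum := Finset.sum_le_sum fun σ (_ : σ ∈ Finset.univ) => hpt σ
  rw [Finset.sum_add_distrib, Finset.sum_sub_distrib, sum_shuffleDensity n M hM, sum_const_perm,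
    Finset.sum_sub_distrib, sum_const_perm, ← Finset.mul_sum] at hsum
  have hv : 2 / (K ^ 2 * n) * ∑ σ : Equiv.Perm (Fin n), rDev n σ ^ 2 ≤
      2 / (K ^ 2 * n) * (n.factorial * n) :=
    mul_le_mul_of_nonneg_left (sum_rDev_sq_le (by omega)) (by positivity)
  have h9 : 2 / (K ^ 2 * n) * (n.factorial * n) = n.factorial * (2 * (1 / K ^ 2)) := by
    field_simp
  rw [tv_Qs_Us, ← mul_assoc, mul_comm (1 / 2 : ℝ), mul_assoc, le_inv_mul_iff₀ hf]
  linarith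

theorem abs_dOf_le_abs_sub {t : ℝ} (ht : 1 / 2 ≤ t) (k : ℕ) : |dOf t| ≤ |t - k| := by
  rw [dOf, if_neg (not_lt.2 ht)]
  exact_mod_cast round_le t (k : ℤ)

theorem mul_sqrt_div_pow_eq_exp {n m : ℕ} (hn : 0 < n) (hm : 2 ≤ m) (k : ℕ) :
    (n : ℝ) * √n / ((m ^ k : ℕ) : ℝ) =
      Real.exp (Real.log m * (3 * Real.log n / (2 * Real.log m) - k)) := by
  have hnr : (0 : ℝ) < n := by positivity
  have hmr : (1 : ℝ) < m := by exact_mod_cast hm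
  have hl : 0 < Real.log m := Real.log_pos hmr
  have h : Real.log m * (3 * Real.log n / (2 * Real.log m) - k) =
      Real.log n + Real.log n / 2 - k * Real.log m := by
    field_simp
    ring
  rw [h, Real.exp_sub, Real.exp_add, Real.exp_log hnr, ← Real.log_sqrt hnr.le,
    Real.exp_log (Real.sqrt_pos.2 hnr), Real.exp_nat_mul, Real.exp_log (by linarith)]
  push_cast
  rfl

theorem min_le_mul_sqrt_div_pow {n m k : ℕ} (hn : 0 < n) (hm : 2 ≤ m)
    (hk : (k : ℝ) ≤ 3 * Real.log n / (2 * Real.log m)) :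
    min (n : ℝ) (|dOf (3 * Real.log n / (2 * Real.log m))| * Real.log m) ≤
      n * √n / ((m ^ k : ℕ) : ℝ) := by
  have hl : 0 < Real.log m := Real.log_pos (by exact_mod_cast hm)
  set t : ℝ := 3 * Real.log n / (2 * Real.log m) with ht
  rcases lt_or_ge t (1 / 2) with h | h
  · have hk0 : k = 0 := by
      have : (k : ℝ) < 1 := by linarith
      have : k < 1 := by exact_mod_cast this
      omega
    subst hk0
    have h1 : (1 : ℝ) ≤ √n := Real.one_le_sqrt.2 (by exact_mod_cast hn)
    have h2 : (0 : ℝ) ≤ n := by positivity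
    refine (min_le_left _ _).trans ?_
    simp only [pow_zero, Nat.cast_one, div_one]
    nlinarith
  · refine (min_le_right _ _).trans ?_
    rw [mul_sqrt_div_pow_eq_exp hn hm]
    have h1 := abs_dOf_le_abs_sub h k
    rw [abs_of_nonneg (sub_nonneg.2 hk)] at h1
    have h2 := Real.add_one_le_exp (Real.log m * (t - k))
    nlinarith

theorem mul_sqrt_div_pow_le {n m k : ℕ} (hn : 2 ≤ n) (hm : 2 ≤ m)
    (hk : 3 * Real.log n / (2 * Real.log m) ≤ (k : ℝ))
    (hd : 0 < |dOf (3 * Real.log n / (2 * Real.log m))| * Real.log m) :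
    n * √n / ((m ^ k : ℕ) : ℝ) ≤
      (|dOf (3 * Real.log n / (2 * Real.log m))| * Real.log m)⁻¹ := by
  have hl : 0 < Real.log m := Real.log_pos (by exact_mod_cast hm)
  have hln : 0 < Real.log n := Real.log_pos (by exact_mod_cast hn)
  rw [mul_sqrt_div_pow_eq_exp (by omega) hm]
  set t : ℝ := 3 * Real.log n / (2 * Real.log m) with ht
  have ht0 : 0 < t := by positivity
  have h1 : |dOf t| ≤ k - t := by
    rcases lt_or_ge t (1 / 2) with h | h
    · have hk1 : (1 : ℝ) ≤ k := by
        have : (0 : ℝ) < k := by linarith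
        exact_mod_cast this
      rw [dOf, if_pos h, abs_of_pos (by norm_num)]
      linarith
    · have := abs_dOf_le_abs_sub h k
      rwa [abs_sub_comm, abs_of_nonneg (sub_nonneg.2 hk)] at this
  have h2 : Real.log m * (t - k) ≤ -(|dOf t| * Real.log m) := by nlinarith
  have h3 := Real.add_one_le_exp (|dOf t| * Real.log m)
  calc Real.exp (Real.log m * (t - k)) ≤ Real.exp (-(|dOf t| * Real.log m)) :=
        Real.exp_le_exp.2 h2
    _ = (Real.exp (|dOf t| * Real.log m))⁻¹ := Real.exp_neg _
    _ ≤ _ := by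
        gcongr
        linarith

/-- If `m_n → ∞` and `|d(t_n)|·μ_n → ∞` then there is a `(t_n, 0)` cutoff. -/
theorem m_shuffle_zero_window_cutoff (m : ℕ → ℕ) (hm : ∀ n, 2 ≤ m n)
    (hm' : Filter.Tendsto m Filter.atTop Filter.atTop)
    (hd : Filter.Tendsto
      (fun n : ℕ => |dOf (3 * Real.log n / (2 * Real.log (m n)))| * Real.log (m n))
      Filter.atTop Filter.atTop) :
    Filter.Tendsto (fun n : ℕ =>
      sInf {x : ℝ | ∃ k : ℕ, (k : ℝ) ≤ 3 * Real.log n / (2 * Real.log (m n)) ∧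
        x = tv n (iterConv n (Qs n (m n)) k) (Us n)}) Filter.atTop (nhds 1) ∧
    Filter.Tendsto (fun n : ℕ =>
      sSup {x : ℝ | ∃ k : ℕ, 3 * Real.log n / (2 * Real.log (m n)) ≤ (k : ℝ) ∧
        x = tv n (iterConv n (Qs n (m n)) k) (Us n)}) Filter.atTop (nhds 0) := by
  simp only [iterConv_Qs]
  have hpos : ∀ n k, 0 < m n ^ k := fun n k => pow_pos (by have := hm n; omega) k
  have hcast : Tendsto (fun n : ℕ => (n : ℝ)) atTop atTop := tendsto_natCast_atTop_atTop
  have hlog : ∀ n : ℕ, 0 ≤ 3 * Real.log n / (2 * Real.log (m n)) := fun n => by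
    have h1 : 0 ≤ Real.log n := Real.log_natCast_nonneg n
    have h2 : 0 ≤ Real.log (m n) := Real.log_natCast_nonneg (m n)
    positivity
  constructor
  · rw [Metric.tendsto_atTop']
    intro ε hε
    obtain ⟨K, hK1, hKε⟩ : ∃ K : ℝ, 1 ≤ K ∧ 1 / K < ε / 2 := by
      refine ⟨max 1 (4 / ε), le_max_left _ _, ?_⟩
      rw [div_lt_iff₀ (by positivity)]
      have h1 : ε / 2 * (4 / ε) ≤ ε / 2 * max 1 (4 / ε) := by
        gcongr
        exact le_max_right _ _
      have h2 : ε / 2 * (4 / ε) = 2 := by field_simp; norm_num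
      linarith
    have hev := (hcast.eventually_ge_atTop (max (256 * K) (48 / ε))).and
      ((hd.eventually_ge_atTop (max (256 * K) (48 / ε))).and
        ((hcast.eventually_ge_atTop (16 * K ^ 2)).and (eventually_ge_atTop 2)))
    obtain ⟨N, hN⟩ := eventually_atTop.1 hev
    refine ⟨N, fun n hn => ?_⟩
    obtain ⟨hn1, hn2, hn3, hn4⟩ := hN n hn.le
    have hlow : ∀ k : ℕ, (k : ℝ) ≤ 3 * Real.log n / (2 * Real.log (m n)) →
        1 - ε * (3 / 4) ≤ tv n (Qs n (m n ^ k)) (Us n) := by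
      intro k hk
      have hq := (le_min hn1 hn2).trans (min_le_mul_sqrt_div_pow (by omega) (hm n) hk)
      have hs : K * √(n : ℝ) ≤ n / 4 := by
        have h1 : 4 * K ≤ √n := Real.le_sqrt_of_sq_le (by linarith)
        have h2 : √(n : ℝ) * √n = n := Real.mul_self_sqrt (by positivity)
        nlinarith [Real.sqrt_nonneg (n : ℝ)]
      have h := le_tv_Qs (by linarith) hn4 (hpos n k) hs ((le_max_left _ _).trans hq)
      have h1 : 12 / (n * √n / ((m n ^ k : ℕ) : ℝ)) ≤ ε / 4 := by
        have h2 := (le_max_right (256 * K) (48 / ε)).trans hq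
        calc 12 / (n * √n / ((m n ^ k : ℕ) : ℝ)) ≤ 12 / (48 / ε) := by gcongr
          _ = ε / 4 := by field_simp; norm_num
      have h3 : 1 / K ^ 2 ≤ 1 / K := by
        gcongr
        nlinarith
      linarith
    rw [Real.dist_eq, abs_lt]
    constructor
    · have : 1 - ε * (3 / 4) ≤ sInf {x : ℝ | ∃ k : ℕ,
          (k : ℝ) ≤ 3 * Real.log n / (2 * Real.log (m n)) ∧
          x = tv n (Qs n (m n ^ k)) (Us n)} := by
        refine le_csInf ⟨_, 0, by simpa using hlog n, rfl⟩ ?_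
        rintro x ⟨k, hk, rfl⟩
        exact hlow k hk
      linarith
    · have : sInf {x : ℝ | ∃ k : ℕ, (k : ℝ) ≤ 3 * Real.log n / (2 * Real.log (m n)) ∧
          x = tv n (Qs n (m n ^ k)) (Us n)} ≤ tv n (Qs n (m n ^ 0)) (Us n) := by
        refine csInf_le ⟨0, ?_⟩ ⟨0, by simpa using hlog n, rfl⟩
        rintro x ⟨k, _, rfl⟩
        exact tv_nonneg _ _ _
      have := tv_Qs_le_one n (m n ^ 0) (hpos n 0)
      linarith
  · have hbound : Tendsto (fun n : ℕ =>
        2 * (|dOf (3 * Real.log n / (2 * Real.log (m n)))| * Real.log (m n))⁻¹ +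
        (|dOf (3 * Real.log n / (2 * Real.log (m n)))| * Real.log (m n))⁻¹ ^ 2 / 4)
        atTop (nhds 0) := by
      have h := hd.inv_tendsto_atTop
      simpa using (h.const_mul 2).add ((h.pow 2).div_const 4)
    refine tendsto_of_tendsto_of_tendsto_of_le_of_le' tendsto_const_nhds hbound
      (Eventually.of_forall fun n => Real.sSup_nonneg ?_) ?_
    · rintro x ⟨k, _, rfl⟩
      exact tv_nonneg _ _ _
    · filter_upwards [hd.eventually_gt_atTop 0, eventually_ge_atTop 2] with n hn1 hn2
      refine Real.sSup_le ?_ (by positivity)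
      rintro x ⟨k, hk, rfl⟩
      have hq := mul_sqrt_div_pow_le hn2 (hm n) hk hn1
      refine (tv_Qs_le (by omega) (hpos n k)).trans ?_
      gcongr
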